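/- Let R1 and R2 be relations over attribute sets U1 and U2, F a filter over U1 ∪ U2, and let u¹ ∈ U1 ∖ U2 and u² ∈ U2 ∖ U1. Then R1 ⟕_{F ∧ (u¹ = u²)} R2 ≡ R1 ⟕_F ν_{u¹↦u²} R2, where ν_{u¹↦u²} R2 extends each tuple of R2 by the attribute u¹ carrying the value of u² (so that the left join on the right-hand side is additionally natural on u¹). -/

import Mathlib

noncomputable section
open Classical

attribute [local instance 10] Classical.propDecidable

namespace RA

variable {A Δ : Type} [DecidableEq A] [DecidableEq Δ]

/-- Three-valued logic: true, false, unknown (error). -/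
inductive TV where
  | tt | ff | unk
deriving DecidableEq

/-- Kleene conjunction. -/
def TV.and : TV → TV → TV
  | .ff, _ => .ff
  | _, .ff => .ff
  | .tt, .tt => .tt
  | _, _ => .unk

/-- Kleene negation. -/
def TV.not : TV → TV
  | .tt => .ff
  | .ff => .tt
  | .unk => .unk

mutual
/-- Terms over attributes `A` and domain `Δ`: attributes, constants and conditionals. -/
inductive Term (A Δ : Type) where
  | attr : A → Term A Δ
  | const : Δ → Term A Δ
  | ite : Filter A Δ → Term A Δ → Term A Δ → Term A Δ

/-- RA filters: `isNull` on a (finite) set of terms, equality, conjunction, negation. -/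
inductive Filter (A Δ : Type) where
  | isNull : List (Term A Δ) → Filter A Δ
  | eq : Term A Δ → Term A Δ → Filter A Δ
  | and : Filter A Δ → Filter A Δ → Filter A Δ
  | not : Filter A Δ → Filter A Δ
end

/-- Disjunction: `F1 ∨ F2 = ¬(¬F1 ∧ ¬F2)`. -/
def Filter.or (F1 F2 : Filter A Δ) : Filter A Δ := .not ((Filter.not F1).and (Filter.not F2))

/-- The tautological filter ⊤ (`isNull` of the empty set of terms is always true). -/
def Filter.tru : Filter A Δ := .isNull []

/-- A tuple over a set of attributes: `none` marks attributes outside the set. -/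
abbrev Tuple (A Δ : Type) := A → Option Δ

mutual
/-- Evaluation of a term on a tuple (`null` is the distinguished null value of `Δ`). -/
def Term.eval (null : Δ) (t : Tuple A Δ) : Term A Δ → Δ
  | .attr a => (t a).getD null
  | .const c => c
  | .ite F v v' => if F.eval null t = TV.tt then v.eval null t else v'.eval null t

def Term.evalList (null : Δ) (t : Tuple A Δ) : List (Term A Δ) → List Δ
  | [] => []
  | v :: vs => v.eval null t :: Term.evalList null t vs

/-- Three-valued evaluation of a filter on a tuple. -/
def Filter.eval (null : Δ) (t : Tuple A Δ) : Filter A Δ → TV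
  | .isNull V => if ∀ d ∈ Term.evalList null t V, d = null then .tt else .ff
  | .eq v v' =>
      if v.eval null t = null ∨ v'.eval null t = null then .unk
      else if v.eval null t = v'.eval null t then .tt else .ff
  | .and F1 F2 => (F1.eval null t).and (F2.eval null t)
  | .not F => (F.eval null t).not
end

mutual
/-- Attributes occurring in a term. -/
def Term.attrs : Term A Δ → Finset A
  | .attr a => {a}
  | .const _ => ∅
  | .ite F v v' => F.attrs ∪ v.attrs ∪ v'.attrs

def Term.attrsList : List (Term A Δ) → Finset A
  | [] => ∅
  | v :: vs => v.attrs ∪ Term.attrsList vs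

/-- Attributes occurring in a filter. -/
def Filter.attrs : Filter A Δ → Finset A
  | .isNull V => Term.attrsList V
  | .eq v v' => v.attrs ∪ v'.attrs
  | .and F1 F2 => F1.attrs ∪ F2.attrs
  | .not F => F.attrs
end

/-- A term is over `U` if all its attributes are in `U`. -/
def Term.over (v : Term A Δ) (U : Finset A) : Prop := v.attrs ⊆ U

/-- A filter is over `U` if all its attributes are in `U`. -/
def Filter.over (F : Filter A Δ) (U : Finset A) : Prop := F.attrs ⊆ U

/-- A tuple is over `U` if its domain is exactly `U`. -/
def Tuple.isOver (t : Tuple A Δ) (U : Finset A) : Prop := ∀ a, (t a).isSome ↔ a ∈ U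

/-- A relation is a bag (multiset) of tuples. -/
abbrev Rel (A Δ : Type) := Multiset (Tuple A Δ)

/-- A relation is over `U` if all its tuples are. -/
def Rel.isOver (R : Rel A Δ) (U : Finset A) : Prop := ∀ t ∈ R, t.isOver U

/-- Selection σ_F. -/
def select (null : Δ) (F : Filter A Δ) (R : Rel A Δ) : Rel A Δ :=
  R.filter (fun t => F.eval null t = .tt)

/-- Restriction of a tuple to the attributes in `U`. -/
def Tuple.restrict (t : Tuple A Δ) (U : Finset A) : Tuple A Δ :=
  fun a => if a ∈ U then t a else none

/-- Projection π_U (bag semantics: multiplicities are added up). -/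
def proj (U : Finset A) (R : Rel A Δ) : Rel A Δ := R.map (·.restrict U)

/-- Bag difference: `(R1 ∖ R2)(t) = R1(t)` if `t ∉ R2` and `0` otherwise. -/
def bdiff (R1 R2 : Rel A Δ) : Rel A Δ := R1.filter (fun t => t ∉ R2)

/-- Compatibility of tuples: equal and non-null on the shared attributes. -/
def Compat (null : Δ) (t1 t2 : Tuple A Δ) : Prop :=
  ∀ a, (t1 a).isSome → (t2 a).isSome → (t1 a = t2 a ∧ t1 a ≠ some null)

/-- `t1 ⊕ t2`: the common extension of two (compatible) tuples. -/
def Tuple.merge (t1 t2 : Tuple A Δ) : Tuple A Δ :=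
  fun a => (t1 a).or (t2 a)

/-- Natural join. -/
def join (null : Δ) (R1 R2 : Rel A Δ) : Rel A Δ :=
  (R1.product R2).filterMap
    (fun p => if Compat null p.1 p.2 then some (p.1.merge p.2) else none)

/-- Natural join with a filter: `R1 ⋈_F R2 = σ_F (R1 ⋈ R2)`. -/
def joinF (null : Δ) (F : Filter A Δ) (R1 R2 : Rel A Δ) : Rel A Δ :=
  select null F (join null R1 R2)

/-- Padding of a tuple with `null` on the attributes of `V`. -/
def Tuple.pad (null : Δ) (V : Finset A) (t : Tuple A Δ) : Tuple A Δ :=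
  fun a => if a ∈ V then (t a).or (some null) else t a

/-- Outer union of `R1` over `U1` and `R2` over `U2`:
each relation is padded with nulls on the attributes missing from it. -/
def ounion (null : Δ) (U1 U2 : Finset A) (R1 R2 : Rel A Δ) : Rel A Δ :=
  R1.map (Tuple.pad null (U2 \ U1)) + R2.map (Tuple.pad null (U1 \ U2))

/-- Left join `R1 ⟕_F R2 = (R1 ⋈_F R2) ⊎ (R1 ∖ π_{U1}(R1 ⋈_F R2))`
for `R1` over `U1` and `R2` over `U2`. -/
def ljoin (null : Δ) (U1 U2 : Finset A) (F : Filter A Δ) (R1 R2 : Rel A Δ) : Rel A Δ :=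
  ounion null (U1 ∪ U2) U1 (joinF null F R1 R2) (bdiff R1 (proj U1 (joinF null F R1 R2)))

/-- Natural left join `R1 ⟕ R2 = R1 ⟕_⊤ R2`. -/
def nljoin (null : Δ) (U1 U2 : Finset A) (R1 R2 : Rel A Δ) : Rel A Δ :=
  ljoin null U1 U2 Filter.tru R1 R2

/-- Extension ν_{u↦v}. -/
def extend (null : Δ) (u : A) (v : Term A Δ) (R : Rel A Δ) : Rel A Δ :=
  R.map (fun t a => if a = u then some (v.eval null t) else t a)

/-- Duplicate elimination δ. -/
def dedup (R : Rel A Δ) : Rel A Δ := R.dedup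

/-- Extended renaming ρ^V_{{u/f(u) | u ∈ S}} at the level of tuples:
each attribute `u ∈ S` receives the value of the term `f u` (evaluated on the original
tuple) and the attributes of `V ∖ S` are projected away. -/
def renameFun (null : Δ) (V S : Finset A) (f : A → Term A Δ) (t : Tuple A Δ) : Tuple A Δ :=
  fun a => if a ∈ S then some ((f a).eval null t) else if a ∈ V then none else t a

/-- Extended renaming ρ^V_{{u/f(u) | u ∈ S}}. -/
def rename (null : Δ) (V S : Finset A) (f : A → Term A Δ) (R : Rel A Δ) : Rel A Δ :=
  R.map (renameFun null V S f)

/-- Renaming of the attribute `uold` into `unew` at the level of tuples. -/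
def renameAttrT (unew uold : A) (t : Tuple A Δ) : Tuple A Δ :=
  fun a => if a = unew then t uold else if a = uold then none else t a

/-- `R[unew/uold]`: the relation `R` with the attribute `uold` renamed to `unew`. -/
def renameAttr (unew uold : A) (R : Rel A Δ) : Rel A Δ := R.map (renameAttrT unew uold)

/-- `coalesce(v, v') = if(¬isNull(v), v, v')`. -/
def Term.coalesce (v v' : Term A Δ) : Term A Δ := .ite (.not (.isNull [v])) v v'

/-- The filter `⋀_{u ∈ K} ¬isNull(u)`. -/
def notNullAll (K : Finset A) : Filter A Δ :=
  K.toList.foldr (fun u acc => (Filter.not (.isNull [.attr u])).and acc) Filter.tru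

mutual
/-- `nullify_S`: replace every occurrence of an attribute from `S` by the constant null. -/
def Term.nullify (null : Δ) (S : Finset A) : Term A Δ → Term A Δ
  | .attr a => if a ∈ S then .const null else .attr a
  | .const c => .const c
  | .ite F v v' => .ite (F.nullify null S) (v.nullify null S) (v'.nullify null S)

def Term.nullifyList (null : Δ) (S : Finset A) : List (Term A Δ) → List (Term A Δ)
  | [] => []
  | v :: vs => v.nullify null S :: Term.nullifyList null S vs

/-- `nullify_S` on filters. -/
def Filter.nullify (null : Δ) (S : Finset A) : Filter A Δ → Filter A Δ
  | .isNull V => .isNull (Term.nullifyList null S V)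
  | .eq v v' => .eq (v.nullify null S) (v'.nullify null S)
  | .and F1 F2 => .and (F1.nullify null S) (F2.nullify null S)
  | .not F => .not (F.nullify null S)
end

/-- p-equivalence of filters over `U`: they are ⊤ on the same tuples over `U`. -/
def pequiv (null : Δ) (U : Finset A) (F1 F2 : Filter A Δ) : Prop :=
  ∀ t : Tuple A Δ, t.isOver U → (F1.eval null t = TV.tt ↔ F2.eval null t = TV.tt)

end RA

namespace RA

theorem TV.and_eq_tt_iff (x y : TV) : x.and y = .tt ↔ x = .tt ∧ y = .tt := by
  cases x <;> cases y <;> simp [TV.and]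

theorem Filter.eval_and_eq_tt_iff {A Δ : Type} [DecidableEq Δ]
    (null : Δ) (t : Tuple A Δ) (F G : Filter A Δ) :
    (F.and G).eval null t = .tt ↔ F.eval null t = .tt ∧ G.eval null t = .tt := by
  rw [Filter.eval, TV.and_eq_tt_iff]

theorem filterMap_congr {α β : Type*} {s : Multiset α} {f g : α → Option β}
    (h : ∀ a ∈ s, f a = g a) : s.filterMap f = s.filterMap g := by
  induction s using Multiset.induction_on with
  | empty => rfl
  | cons a s ih =>
    rw [Multiset.filterMap_cons, Multiset.filterMap_cons, h a (Multiset.mem_cons_self a s),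
      ih fun b hb => h b (Multiset.mem_cons_of_mem hb)]

theorem product_map_right {α β γ : Type*} (s : Multiset α) (t : Multiset β) (g : β → γ) :
    s.product (t.map g) = (s.product t).map (Prod.map id g) := by
  change s.bind _ = Multiset.map _ (s.bind _)
  simp [Multiset.map_bind, Multiset.map_map]

/-- Extending `t2` by `u1` with the value of `u2` makes compatibility with `t1` additionally
require that `u1` and `u2` carry equal values other than `null`. -/
theorem compat_extend_iff {A Δ : Type} [DecidableEq A]
    (null : Δ) (u1 u2 : A) (t1 t2 : Tuple A Δ)
    (h1 : (t1 u1).isSome) (h21 : t2 u1 = none) :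
    Compat null t1 (fun a => if a = u1 then some ((t2 u2).getD null) else t2 a) ↔
      Compat null t1 t2 ∧ t1 u1 = some ((t2 u2).getD null) ∧ t1 u1 ≠ some null := by
  constructor
  · intro h
    refine ⟨fun a ha hb => ?_, by simpa using h u1 h1 (by simp)⟩
    have hne : a ≠ u1 := by rintro rfl; simp [h21] at hb
    simpa [hne] using h a ha (by simpa [hne] using hb)
  · rintro ⟨h, he⟩ a ha hb
    by_cases hau : a = u1
    · subst hau; simpa using he
    · simpa [hau] using h a ha (by simpa [hau] using hb)

/-- Extending `t2` by an attribute on which `t1` is defined does not change `t1 ⊕ t2`. -/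
theorem merge_extend {A Δ : Type} [DecidableEq A]
    (u1 : A) (d : Δ) (t1 t2 : Tuple A Δ) (h1 : (t1 u1).isSome) :
    t1.merge (fun a => if a = u1 then some d else t2 a) = t1.merge t2 := by
  funext a
  by_cases hau : a = u1
  · subst hau
    obtain ⟨x, hx⟩ := Option.isSome_iff_exists.mp h1
    simp [Tuple.merge, hx]
  · simp [Tuple.merge, hau]

theorem eval_eq_attr_merge {A Δ : Type} [DecidableEq Δ]
    (null : Δ) (u1 u2 : A) (t1 t2 : Tuple A Δ)
    (h1 : (t1 u1).isSome) (h12 : t1 u2 = none) :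
    (Filter.eq (.attr u1) (.attr u2)).eval null (t1.merge t2) = .tt ↔
      t1 u1 = some ((t2 u2).getD null) ∧ t1 u1 ≠ some null := by
  obtain ⟨x, hx⟩ := Option.isSome_iff_exists.mp h1
  simp only [Filter.eval, Term.eval, Tuple.merge, hx, h12, Option.some_or, Option.none_or,
    Option.getD_some]
  split_ifs <;> grind

/-- A join condition `u1 = u2` can be replaced by extending the right-hand relation. -/
theorem joinF_and_eq {A Δ : Type} [DecidableEq A] [DecidableEq Δ]
    (null : Δ) (U1 U2 : Finset A) (R1 R2 : Rel A Δ) (F : Filter A Δ) (u1 u2 : A)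
    (hR1 : R1.isOver U1) (hR2 : R2.isOver U2)
    (hu1 : u1 ∈ U1 \ U2) (hu2 : u2 ∈ U2 \ U1) :
    joinF null (F.and (.eq (.attr u1) (.attr u2))) R1 R2
      = joinF null F R1 (extend null u1 (.attr u2) R2) := by
  rw [Finset.mem_sdiff] at hu1 hu2
  unfold joinF select join extend
  rw [product_map_right, Multiset.filterMap_map, Multiset.filter_filterMap,
    Multiset.filter_filterMap]
  refine filterMap_congr fun p hp => ?_
  obtain ⟨t1, t2⟩ := p
  obtain ⟨m1, m2⟩ := Multiset.mem_product.mp hp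
  have h1 : (t1 u1).isSome := (hR1 t1 m1 u1).mpr hu1.1
  have h12 : t1 u2 = none := by
    simpa using (hR1 t1 m1 u2).not.mpr hu2.2
  have h21 : t2 u1 = none := by
    simpa using (hR2 t2 m2 u1).not.mpr hu1.2
  have hc := compat_extend_iff null u1 u2 t1 t2 h1 h21
  have he := eval_eq_attr_merge null u1 u2 t1 t2 h1 h12
  have hm := merge_extend u1 ((t2 u2).getD null) t1 t2 h1
  generalize (t1 u1 = some ((t2 u2).getD null) ∧ t1 u1 ≠ some null) = E at hc he
  simp only [Function.comp_apply, Prod.map_apply, id_eq, Term.eval, hc, hm]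
  by_cases hC : Compat null t1 t2 <;> by_cases hE : E <;>
    simp [hC, hE, Option.filter, Filter.eval_and_eq_tt_iff, he]

end RA

namespace RA

variable {A Δ : Type} [DecidableEq A] [DecidableEq Δ]

theorem stmt7 (null : Δ) (U1 U2 : Finset A) (R1 R2 : Rel A Δ) (F : Filter A Δ) (u1 u2 : A)
    (hR1 : R1.isOver U1) (hR2 : R2.isOver U2) (hF : F.over (U1 ∪ U2))
    (hu1 : u1 ∈ U1 \ U2) (hu2 : u2 ∈ U2 \ U1) :
    ljoin null U1 U2 (F.and (.eq (.attr u1) (.attr u2))) R1 R2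
      = ljoin null U1 (insert u1 U2) F R1 (extend null u1 (.attr u2) R2) := by
  have hU : U1 ∪ insert u1 U2 = U1 ∪ U2 := by
    rw [Finset.union_insert, Finset.insert_eq_of_mem
      (Finset.mem_union_left _ (Finset.mem_sdiff.mp hu1).1)]
  unfold ljoin
  rw [joinF_and_eq null U1 U2 R1 R2 F u1 u2 hR1 hR2 hu1 hu2, hU]

end RA
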